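/- arXiv:1808.02669 — 2 statements merged into one kernel-verified Lean document; each statement's English description precedes it below -/
import Mathlib

section
/- Let a, b ∈ A with finite spectra, and suppose ϱ(a,b) = 0 and ϱ(b,a) = 0 (i.e., a and b are quasinilpotent equivalent). Then there exist quasinilpotent elements r_a commuting with a and r_b commuting with b such that a - r_a = b - r_b. -/
open Filter in
noncomputable def varrho {A : Type*} [NormedRing A] (a b : A) : ℝ :=
  atTop.limsup fun n : ℕ => ‖(fun x => a * x - x * b)^[n] 1‖ ^ ((n : ℝ)⁻¹)


open Filter Topology

def QDecay (u : ℕ → ℝ) : Prop := ∀ ε > 0, ∃ K : ℝ, 0 ≤ K ∧ ∀ n, u n ≤ K * ε ^ n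

lemma QDecay.of_eventually {u : ℕ → ℝ} (hu : ∀ n, 0 ≤ u n)
    (h : ∀ ε > 0, ∀ᶠ n : ℕ in atTop, u n ^ ((n : ℝ)⁻¹) < ε) : QDecay u := by
  intro ε hε
  obtain ⟨N, hN⟩ := eventually_atTop.1 (h ε hε)
  refine ⟨1 + ∑ i ∈ Finset.range (N + 1), u i / ε ^ i, ?_, ?_⟩
  · have : 0 ≤ ∑ i ∈ Finset.range (N + 1), u i / ε ^ i :=
      Finset.sum_nonneg fun i _ => div_nonneg (hu i) (by positivity)
    linarith
  intro n
  by_cases hn : n < N + 1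
  · have h1 : u n / ε ^ n ≤ ∑ i ∈ Finset.range (N + 1), u i / ε ^ i :=
      Finset.single_le_sum (f := fun i => u i / ε ^ i)
        (fun i _ => div_nonneg (hu i) (by positivity)) (Finset.mem_range.2 hn)
    rw [← div_le_iff₀ (by positivity)]
    linarith
  · have h1 := hN n (by omega)
    have hn0 : n ≠ 0 := by omega
    have h2 : u n ≤ ε ^ n := by
      have := pow_le_pow_left₀ (Real.rpow_nonneg (hu n) _) h1.le n
      rwa [Real.rpow_inv_natCast_pow (hu n) hn0] at this
    have h3 : 0 ≤ ∑ i ∈ Finset.range (N + 1), u i / ε ^ i :=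
      Finset.sum_nonneg fun i _ => div_nonneg (hu i) (by positivity)
    have : 0 < ε ^ n := by positivity
    nlinarith

lemma QDecay.nonpos {u : ℕ → ℝ} (hu : QDecay u) {t c : ℝ} (ht : 0 < t)
    (h : ∀ n, t ^ n * c ≤ u n) : c ≤ 0 := by
  obtain ⟨K, hK, hK'⟩ := hu (t / 2) (by positivity)
  have h1 : ∀ n : ℕ, c ≤ K * (1 / 2) ^ n := by
    intro n
    have h2 := (h n).trans (hK' n)
    have h3 : K * (t / 2) ^ n = t ^ n * (K * (1 / 2) ^ n) := by
      rw [div_eq_mul_one_div, mul_pow]; ring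
    rw [h3] at h2
    exact le_of_mul_le_mul_left h2 (by positivity)
  have h2 : Tendsto (fun n : ℕ => K * (1 / 2 : ℝ) ^ n) atTop (𝓝 (K * 0)) :=
    (tendsto_pow_atTop_nhds_zero_of_lt_one (by norm_num) (by norm_num)).const_mul K
  have := ge_of_tendsto' h2 h1
  simpa using this

lemma QDecay.of_spectralRadius {A : Type*} [NormedRing A] [NormedAlgebra ℂ A] [CompleteSpace A]
    {x : A} (hx : spectralRadius ℂ x = 0) : QDecay fun n => ‖x ^ n‖ := by
  apply QDecay.of_eventually (fun n => norm_nonneg _)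
  intro ε hε
  have h := spectrum.pow_norm_pow_one_div_tendsto_nhds_spectralRadius x
  rw [hx] at h
  have := h.eventually_lt_const (u := ENNReal.ofReal ε) (by simpa using hε)
  filter_upwards [this] with n hn
  rw [ENNReal.ofReal_lt_ofReal_iff hε] at hn
  simpa using hn

lemma QDecay.spectralRadius {A : Type*} [NormedRing A] [NormedAlgebra ℂ A] [CompleteSpace A]
    {x : A} (hx : QDecay fun n => ‖x ^ n‖) : spectralRadius ℂ x = 0 := by
  unfold _root_.spectralRadius
  simp only [ENNReal.iSup_eq_zero]
  intro z hz
  by_contra hne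
  have hz0 : 0 < ‖z‖ := by
    rw [norm_pos_iff]; rintro rfl; simp at hne
  have h1 : QDecay fun n => ‖x ^ n‖ * ‖(1 : A)‖ := by
    intro ε hε
    obtain ⟨K, hK, h⟩ := hx ε hε
    refine ⟨K * ‖(1 : A)‖, by positivity, fun n => ?_⟩
    have := mul_le_mul_of_nonneg_right (h n) (norm_nonneg (1 : A))
    linarith
  have := h1.nonpos hz0 (c := 1) (fun n => by
    have h2 : z ^ n ∈ spectrum ℂ (x ^ n) := spectrum.pow_mem_pow x n hz
    have := spectrum.norm_le_norm_mul_of_mem h2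
    simpa using this)
  linarith

lemma QDecay.of_varrho {A : Type*} [NormedRing A] {a b : A} (h : varrho a b = 0) :
    QDecay fun n => ‖(fun x => a * x - x * b)^[n] 1‖ := by
  apply QDecay.of_eventually (fun n => norm_nonneg _)
  intro ε hε
  unfold varrho at h
  refine eventually_lt_of_limsup_lt (by rw [h]; exact hε) ?_
  have hb : ∀ n : ℕ, ‖(fun x => a * x - x * b)^[n] 1‖ ≤ (‖a‖ + ‖b‖) ^ n * ‖(1 : A)‖ := by
    intro n
    induction n with
    | zero => simp
    | succ n ih =>
      rw [Function.iterate_succ_apply']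
      set y := (fun x => a * x - x * b)^[n] 1
      calc ‖a * y - y * b‖ ≤ ‖a‖ * ‖y‖ + ‖y‖ * ‖b‖ :=
            (norm_sub_le _ _).trans (add_le_add (norm_mul_le _ _) (norm_mul_le _ _))
        _ = (‖a‖ + ‖b‖) * ‖y‖ := by ring
        _ ≤ (‖a‖ + ‖b‖) * ((‖a‖ + ‖b‖) ^ n * ‖(1 : A)‖) := by gcongr
        _ = _ := by ring
  refine isBoundedUnder_of_eventually_le (a := (‖a‖ + ‖b‖) * (‖(1 : A)‖ + 1)) ?_
  filter_upwards [eventually_ne_atTop 0] with n hn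
  have h1 : ‖(fun x => a * x - x * b)^[n] 1‖ ≤ ((‖a‖ + ‖b‖) * (‖(1 : A)‖ + 1)) ^ n := by
    refine (hb n).trans ?_
    rw [mul_pow]
    gcongr
    refine le_trans ?_ (le_self_pow₀ (by linarith [norm_nonneg (1 : A)]) hn)
    linarith
  calc _ ≤ (((‖a‖ + ‖b‖) * (‖(1 : A)‖ + 1)) ^ n) ^ ((n : ℝ)⁻¹) :=
        Real.rpow_le_rpow (norm_nonneg _) h1 (by positivity)
    _ = _ := Real.pow_rpow_inv_natCast (by positivity) hn

lemma QDecay.add_apply {E : Type*} [NormedAddCommGroup E] [NormedSpace ℂ E]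
    {T U : E →L[ℂ] E} (hc : Commute U T) {x : E} (hT : QDecay fun n => ‖(T ^ n) x‖)
    (hU : QDecay fun n => ‖U ^ n‖) : QDecay fun n => ‖((U + T) ^ n) x‖ := by
  intro ε hε
  obtain ⟨K, hK, h1⟩ := hT (ε / 2) (by positivity)
  obtain ⟨L, hL, h2⟩ := hU (ε / 2) (by positivity)
  refine ⟨L * K, by positivity, fun n => ?_⟩
  beta_reduce at h1 h2 ⊢
  rw [hc.add_pow, ContinuousLinearMap.sum_apply]
  calc _ ≤ ∑ m ∈ Finset.range (n + 1), ‖(U ^ m * T ^ (n - m) * (n.choose m : E →L[ℂ] E)) x‖ :=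
        norm_sum_le _ _
    _ ≤ ∑ m ∈ Finset.range (n + 1),
        ((ε / 2) ^ m * (ε / 2) ^ (n - m) * (n.choose m : ℝ)) * (L * K) := by
      refine Finset.sum_le_sum fun m _ => ?_
      rw [← Nat.cast_comm, ← nsmul_eq_mul, ContinuousLinearMap.smul_apply, ContinuousLinearMap.mul_apply]
      calc _ ≤ (n.choose m : ℝ) * ‖(U ^ m) ((T ^ (n - m)) x)‖ := norm_nsmul_le
        _ ≤ (n.choose m : ℝ) * ((L * (ε / 2) ^ m) * (K * (ε / 2) ^ (n - m))) := by
          gcongr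
          refine (ContinuousLinearMap.le_opNorm _ _).trans ?_
          gcongr
          · exact h2 m
          · exact h1 _
        _ = _ := by ring
    _ = _ := by
      rw [← Finset.sum_mul, ← add_pow, add_halves]; ring

lemma choose_half_bound : ∃ K : ℝ, ∀ n : ℕ, ‖Ring.choose (-1 / 2 : ℂ) n‖ ≤ K * 2 ^ n := by
  have h1 : ((1 / 2 : NNReal) : ENNReal) < (binomialSeries ℂ (-1 / 2 : ℂ)).radius := by
    refine lt_of_lt_of_le ?_ binomialSeries_radius_ge_one
    have : (1 / 2 : NNReal) < 1 := by rw [← NNReal.coe_lt_coe]; norm_num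
    exact_mod_cast this
  obtain ⟨C, hC, h⟩ := FormalMultilinearSeries.norm_mul_pow_le_of_lt_radius _ h1
  refine ⟨C, fun n => ?_⟩
  have h2 := h n
  have h3 : ‖binomialSeries ℂ (-1 / 2 : ℂ) n‖ = ‖Ring.choose (-1 / 2 : ℂ) n‖ := by
    simp [binomialSeries, FormalMultilinearSeries.ofScalars_norm]
  rw [h3] at h2
  have h4 : ((1 / 2 : NNReal) : ℝ) ^ n = (2 ^ n)⁻¹ := by
    push_cast; rw [one_div, inv_pow]
  rw [h4, ← div_eq_mul_inv, div_le_iff₀ (by positivity)] at h2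
  exact h2

lemma choose_half_conv (n : ℕ) : ∑ ij ∈ Finset.HasAntidiagonal.antidiagonal n,
    Ring.choose (-1 / 2 : ℂ) ij.1 * Ring.choose (-1 / 2 : ℂ) ij.2 = (-1) ^ n := by
  rw [← Ring.add_choose_eq n (Commute.refl _)]
  have : (-1 / 2 + -1 / 2 : ℂ) = -1 := by norm_num
  rw [this, Ring.choose_neg, show (1 : ℂ) + n - 1 = (n : ℂ) by ring,
    Ring.choose_natCast, Nat.choose_self]
  simp [Int.negOnePow_def, Units.smul_def]

section comm
variable {B : Type*} [NormedCommRing B] [NormedAlgebra ℂ B] [CompleteSpace B]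

open WeakDual

lemma spectralRadius_eq_zero_iff_char (x : B) :
    spectralRadius ℂ x = 0 ↔ ∀ φ : characterSpace ℂ B, φ x = 0 := by
  unfold spectralRadius
  simp only [ENNReal.iSup_eq_zero, WeakDual.CharacterSpace.mem_spectrum_iff_exists]
  constructor
  · intro h φ
    simpa using h _ ⟨φ, rfl⟩
  · rintro h _ ⟨φ, rfl⟩
    simp [h φ]

/-- inverse square root of `1+z`, `z` quasinilpotent -/
lemma exists_inv_sqrt (z : B) (hz : ∀ φ : characterSpace ℂ B, φ z = 0) :
    ∃ f : B, f * f * (1 + z) = 1 ∧ ∀ φ : characterSpace ℂ B, φ f = 1 := by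
  obtain ⟨K, hK⟩ := choose_half_bound
  obtain ⟨L, hL, hz'⟩ := QDecay.of_spectralRadius ((spectralRadius_eq_zero_iff_char z).2 hz)
    (1 / 4) (by norm_num)
  have hK0 : 0 ≤ K := by
    have := (norm_nonneg _).trans (hK 0); simpa using this
  set c : ℕ → ℂ := fun n => Ring.choose (-1 / 2 : ℂ) n with hc
  have hs : Summable fun n => ‖c n • z ^ n‖ := by
    refine Summable.of_nonneg_of_le (fun n => norm_nonneg _) (fun n => ?_)
      ((summable_geometric_of_lt_one (r := (1 / 2 : ℝ)) (by norm_num) (by norm_num)).mul_left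
        (K * L))
    calc _ ≤ ‖c n‖ * ‖z ^ n‖ := norm_smul_le _ _
      _ ≤ (K * 2 ^ n) * (L * (1 / 4) ^ n) := by
        gcongr
        · exact hK n
        · exact hz' n
      _ = K * L * (2 * (1 / 4)) ^ n := by rw [mul_pow]; ring
      _ = _ := by norm_num
  have hs1 : Summable fun n => ‖(-z) ^ n‖ := by
    refine Summable.of_nonneg_of_le (fun n => norm_nonneg _) (fun n => ?_)
      ((summable_geometric_of_lt_one (r := (1 / 4 : ℝ)) (by norm_num) (by norm_num)).mul_left L)
    rw [neg_pow]
    rcases neg_one_pow_eq_or B n with h | h <;> simp only [h, one_mul, neg_mul, norm_neg] <;>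
      exact hz' n
  refine ⟨∑' n, c n • z ^ n, ?_, ?_⟩
  · rw [tsum_mul_tsum_eq_tsum_sum_antidiagonal_of_summable_norm hs hs]
    have h1 : ∀ n : ℕ, ∑ kl ∈ Finset.HasAntidiagonal.antidiagonal n, (c kl.1 • z ^ kl.1) * (c kl.2 • z ^ kl.2)
        = (-z) ^ n := by
      intro n
      have : ∀ kl ∈ Finset.HasAntidiagonal.antidiagonal n, (c kl.1 • z ^ kl.1) * (c kl.2 • z ^ kl.2)
          = (c kl.1 * c kl.2) • z ^ n := by
        intro kl hkl
        rw [smul_mul_smul_comm, ← pow_add, Finset.HasAntidiagonal.mem_antidiagonal.1 hkl]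
      rw [Finset.sum_congr rfl this, ← Finset.sum_smul, choose_half_conv, neg_pow z]
      rcases neg_one_pow_eq_or ℂ n with h | h <;> rcases neg_one_pow_eq_or B n with h' | h' <;>
      rcases Nat.even_or_odd n with h'' | h'' <;> simp [h''.neg_one_pow]
    simp_rw [h1]
    have h2 := hs1.of_norm.tsum_eq_zero_add
    have h3 : ∑' n : ℕ, (-z) ^ (n + 1) = (∑' n : ℕ, (-z) ^ n) * (-z) := by
      simp_rw [pow_succ]; exact (hs1.of_norm.tsum_mul_right _)
    rw [h3, pow_zero] at h2
    linear_combination h2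
  · intro φ
    have h2 := hs.of_norm.map_tsum φ (map_continuous φ)
    rw [h2]
    simp only [map_smul, map_pow, hz φ]
    rw [tsum_eq_single 0]
    · simp [hc]
    · intro n hn; simp [hn]

lemma exists_idem_lift (p : B) (hp : ∀ φ : characterSpace ℂ B, φ p = 0 ∨ φ p = 1) :
    ∃ e : B, e * e = e ∧ ∀ φ : characterSpace ℂ B, φ e = φ p := by
  obtain ⟨f, hf, hf'⟩ := exists_inv_sqrt (4 * (p * p - p)) (by
    intro φ
    simp only [map_mul, map_sub]
    rcases hp φ with h | h <;> simp [h])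
  have h2 : algebraMap ℂ B (1 / 2) * 2 = 1 := by
    rw [← map_ofNat (algebraMap ℂ B) 2, ← map_mul]; norm_num
  set t := algebraMap ℂ B (1 / 2) with ht
  refine ⟨t * (1 + (2 * p - 1) * f), ?_, ?_⟩
  · linear_combination t ^ 2 * hf + (t + t * (2 * p - 1) * f) * h2
  · intro φ
    simp only [map_mul, map_add, map_sub, map_one, hf', ht, map_ofNat, AlgHomClass.commutes]
    simp

lemma idem_eq_zero (e : B) (he : e * e = e) (h : ∀ φ : characterSpace ℂ B, φ e = 0) : e = 0 := by
  have hu : IsUnit (1 - e) := by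
    by_contra hu
    obtain ⟨φ, hφ⟩ := WeakDual.CharacterSpace.exists_apply_eq_zero hu
    simp [h φ] at hφ
  have : (1 - e) * e = 0 := by linear_combination -he
  exact hu.mul_right_eq_zero.1 this

open Polynomial in
lemma comm_decomp (a : B) (S : Finset ℂ) (hS : ∀ φ : characterSpace ℂ B, φ a ∈ S) :
    ∃ e : ℂ → B, (∀ i ∈ S, e i * e i = e i) ∧ (∀ i ∈ S, ∀ j ∈ S, i ≠ j → e i * e j = 0) ∧
      ∑ i ∈ S, e i = 1 ∧ spectralRadius ℂ (a - ∑ i ∈ S, i • e i) = 0 := by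
  have hev : ∀ i ∈ S, ∀ j ∈ S, (Lagrange.basis S id i).eval j = if i = j then 1 else 0 := by
    intro i hi j hj
    split_ifs with h
    · subst h; exact Lagrange.eval_basis_self (v := id) (Set.injOn_id _) hi
    · exact Lagrange.eval_basis_of_ne (v := id) h hj
  have hφ : ∀ φ : characterSpace ℂ B, ∀ i ∈ S,
      φ (aeval a (Lagrange.basis S id i)) = if i = φ a then 1 else 0 := by
    intro φ i hi
    rw [← hev i hi _ (hS φ), ← Polynomial.aeval_algHom_apply φ, Polynomial.coe_aeval_eq_eval]
  have hex : ∀ i : ℂ, ∃ e : B, i ∈ S → e * e = e ∧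
      ∀ φ : characterSpace ℂ B, φ e = if i = φ a then 1 else 0 := by
    intro i
    by_cases hi : i ∈ S
    · obtain ⟨e, h1, h2⟩ := exists_idem_lift (aeval a (Lagrange.basis S id i)) (by
        intro φ; rw [hφ φ i hi]; split_ifs <;> simp)
      exact ⟨e, fun _ => ⟨h1, fun φ => by rw [h2, hφ φ i hi]⟩⟩
    · exact ⟨0, fun h => absurd h hi⟩
  choose e he using hex
  have hidem : ∀ i ∈ S, e i * e i = e i := fun i hi => (he i hi).1
  have horth : ∀ i ∈ S, ∀ j ∈ S, i ≠ j → e i * e j = 0 := by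
    intro i hi j hj hij
    apply idem_eq_zero
    · linear_combination (e j * e j) * hidem i hi + e i * hidem j hj
    · intro φ
      rw [map_mul, (he i hi).2, (he j hj).2]
      split_ifs with h h' <;> simp
      exact hij (h.trans h'.symm)
  refine ⟨e, hidem, horth, ?_, ?_⟩
  · have hsq : (∑ i ∈ S, e i) * (∑ i ∈ S, e i) = ∑ i ∈ S, e i := by
      rw [Finset.sum_mul_sum]
      refine Finset.sum_congr rfl fun i hi => ?_
      rw [Finset.sum_eq_single_of_mem i hi (fun j hj hji => horth i hi j hj hji.symm), hidem i hi]
    have := idem_eq_zero (1 - ∑ i ∈ S, e i) (by linear_combination hsq) (by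
      intro φ
      rw [map_sub, map_sum, Finset.sum_congr rfl (fun i hi => (he i hi).2 φ)]
      simp [hS φ])
    exact (sub_eq_zero.1 this).symm
  · rw [spectralRadius_eq_zero_iff_char]
    intro φ
    rw [map_sub, map_sum, Finset.sum_congr rfl (fun i hi => by rw [map_smul, (he i hi).2 φ])]
    simp [hS φ]

end comm

open Polynomial in
lemma banach_decomp {A : Type*} [NormedRing A] [NormedAlgebra ℂ A] [CompleteSpace A] [Nontrivial A]
    (a : A) (hfa : (spectrum ℂ a).Finite) :
    ∃ (S : Finset ℂ) (e : ℂ → A), (∀ i ∈ S, e i * e i = e i) ∧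
      (∀ i ∈ S, ∀ j ∈ S, i ≠ j → e i * e j = 0) ∧
      ∑ i ∈ S, e i = 1 ∧ spectralRadius ℂ (a - ∑ i ∈ S, i • e i) = 0 ∧
      Commute a (a - ∑ i ∈ S, i • e i) := by
  let B := Algebra.elemental ℂ a
  let _ : NormedCommRing B := { (inferInstance : NormedRing B) with mul_comm := mul_comm }
  let a' : B := ⟨a, Algebra.elemental.self_mem ℂ a⟩
  have hsr : ∀ x : B, spectralRadius ℂ x = 0 → spectralRadius ℂ (x : A) = 0 := by
    intro x hx
    have h := QDecay.of_spectralRadius hx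
    apply QDecay.spectralRadius
    exact h
  let q : ℂ[X] := ∏ i ∈ hfa.toFinset, (X - C i)
  have hq : ∀ z : ℂ, q.eval z = 0 ↔ z ∈ hfa.toFinset := by
    intro z
    simp only [q, eval_prod, Finset.prod_eq_zero_iff, eval_sub, eval_X, eval_C, sub_eq_zero]
    simp
  have hq0 : spectralRadius ℂ (aeval a q) = 0 := by
    unfold spectralRadius
    simp only [ENNReal.iSup_eq_zero, spectrum.map_polynomial_aeval]
    rintro _ ⟨z, hz, rfl⟩
    have := (hq z).2 (by simpa using hz)
    simp [this]
  have hq1 : spectralRadius ℂ (aeval a' q) = 0 := by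
    apply QDecay.spectralRadius
    have h := QDecay.of_spectralRadius hq0
    convert h using 2 with n
    have : ((aeval a' q : B) : A) = aeval a q := (aeval_algHom_apply B.val a' q).symm
    rw [← this]
    rfl
  obtain ⟨e, h1, h2, h3, h4⟩ := comm_decomp a' hfa.toFinset (by
    intro φ
    rw [← hq]
    have := (spectralRadius_eq_zero_iff_char _).1 hq1 φ
    rwa [← Polynomial.aeval_algHom_apply φ, Polynomial.coe_aeval_eq_eval] at this)
  have hcoe : ((a' - ∑ i ∈ hfa.toFinset, i • e i : B) : A)
      = a - ∑ i ∈ hfa.toFinset, i • (e i : A) := by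
    have := map_sub B.val a' (∑ i ∈ hfa.toFinset, i • e i)
    simp only [map_sum, map_smul] at this
    exact this
  refine ⟨hfa.toFinset, fun i => (e i : A), fun i hi => congrArg Subtype.val (h1 i hi),
    fun i hi j hj hij => congrArg Subtype.val (h2 i hi j hj hij), ?_, ?_, ?_⟩
  · have := congrArg B.val h3
    rw [map_sum, map_one] at this
    exact this
  · rw [← hcoe]
    exact hsr _ h4
  · rw [← hcoe]
    exact congrArg Subtype.val (mul_comm a' (a' - ∑ i ∈ hfa.toFinset, i • e i))

lemma QDecay.neg_pow {A : Type*} [NormedRing A] {x : A} (hx : QDecay fun n => ‖x ^ n‖) :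
    QDecay fun n => ‖(-x) ^ n‖ := by
  have : (fun n : ℕ => ‖(-x) ^ n‖) = fun n => ‖x ^ n‖ := by
    funext n
    rw [_root_.neg_pow]
    rcases neg_one_pow_eq_or A n with h | h <;> simp [h]
  rwa [this]

lemma QDecay.mono {u v : ℕ → ℝ} (hu : QDecay u) (h : ∀ n, v n ≤ u n) : QDecay v := by
  intro ε hε
  obtain ⟨K, hK, h'⟩ := hu ε hε
  exact ⟨K, hK, fun n => (h n).trans (h' n)⟩

section ops
variable {A : Type*} [NormedRing A] [NormedAlgebra ℂ A]

noncomputable def opL (a : A) : A →L[ℂ] A := ContinuousLinearMap.mul ℂ A a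
noncomputable def opR (b : A) : A →L[ℂ] A := (ContinuousLinearMap.mul ℂ A).flip b

@[simp] lemma opL_apply (a x : A) : opL a x = a * x := rfl
@[simp] lemma opR_apply (a x : A) : opR a x = x * a := rfl

lemma opL_pow_apply (a : A) (n : ℕ) (x : A) : (opL a ^ n) x = a ^ n * x := by
  induction n with
  | zero => simp
  | succ n ih => rw [pow_succ', pow_succ', mul_assoc, ← ih]; rfl

lemma opR_pow_apply (a : A) (n : ℕ) (x : A) : (opR a ^ n) x = x * a ^ n := by
  induction n with
  | zero => simp
  | succ n ih => rw [pow_succ', pow_succ, ← mul_assoc, ← ih]; rfl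

lemma opL_decay {a : A} (h : QDecay fun n => ‖a ^ n‖) : QDecay fun n => ‖opL a ^ n‖ :=
  h.mono fun n => ContinuousLinearMap.opNorm_le_bound _ (norm_nonneg _) fun x => by
    rw [opL_pow_apply]; exact norm_mul_le _ _

lemma opR_decay {a : A} (h : QDecay fun n => ‖a ^ n‖) : QDecay fun n => ‖opR a ^ n‖ :=
  h.mono fun n => ContinuousLinearMap.opNorm_le_bound _ (norm_nonneg _) fun x => by
    rw [opR_pow_apply, mul_comm]; exact norm_mul_le _ _

lemma commutator_pow_apply (a b : A) (n : ℕ) (x : A) :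
    ((opL a - opR b) ^ n) x = (fun x => a * x - x * b)^[n] x := by
  induction n with
  | zero => simp
  | succ n ih => rw [pow_succ', Function.iterate_succ_apply', ← ih]; rfl

end ops

theorem stmt_5 {A : Type*} [NormedRing A] [NormedAlgebra ℂ A] [CompleteSpace A]
    (a b : A) (hfa : (spectrum ℂ a).Finite) (hfb : (spectrum ℂ b).Finite)
    (hab : varrho a b = 0) (hba : varrho b a = 0) :
    ∃ ra rb : A, spectralRadius ℂ ra = 0 ∧ spectralRadius ℂ rb = 0 ∧
      a * ra = ra * a ∧ b * rb = rb * b ∧ a - ra = b - rb := by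
  rcases subsingleton_or_nontrivial A with hA | hA
  · exact ⟨0, 0, by simp, by simp, by simp, by simp, Subsingleton.elim _ _⟩
  obtain ⟨S, e, he1, he2, he3, he4, he5⟩ := banach_decomp a hfa
  obtain ⟨T, f, hf1, hf2, hf3, hf4, hf5⟩ := banach_decomp b hfb
  set s := ∑ i ∈ S, i • e i with hs
  set t := ∑ i ∈ T, i • f i with ht
  set ra := a - s with hra
  set rb := b - t with hrb
  refine ⟨ra, rb, he4, hf4, he5, hf5, ?_⟩
  suffices hst : s = t by rw [hra, hrb, sub_sub_cancel, sub_sub_cancel, hst]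
  have hC : QDecay fun n => ‖((opL a - opR b) ^ n) 1‖ := by
    simp_rw [commutator_pow_apply]; exact QDecay.of_varrho hab
  have hcR : Commute (opR rb) (opL a - opR b) := by
    ext x
    change (a * x - x * b) * rb = a * (x * rb) - (x * rb) * b
    rw [sub_mul, mul_assoc, mul_assoc, mul_assoc, hf5.eq]
  have h1 := QDecay.add_apply hcR hC (opR_decay (QDecay.of_spectralRadius hf4))
  have hcL : Commute (opL (-ra)) (opR rb + (opL a - opR b)) := by
    ext x
    change -ra * (x * rb + (a * x - x * b)) = (-ra * x) * rb + (a * (-ra * x) - (-ra * x) * b)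
    have : a * (-ra * x) = -ra * (a * x) := by
      simp only [neg_mul, mul_neg, ← mul_assoc, he5.eq]
    rw [this]; simp only [mul_add, mul_sub, mul_assoc]
  have h2 := QDecay.add_apply hcL h1 (opL_decay (QDecay.of_spectralRadius he4).neg_pow)
  have hD : opL (-ra) + (opR rb + (opL a - opR b)) = opL s - opR t := by
    ext x
    change -ra * x + (x * rb + (a * x - x * b)) = s * x - x * t
    rw [hra, hrb]; noncomm_ring
  rw [hD] at h2
  have hes : ∀ i ∈ S, e i * s = i • e i := by
    intro i hi
    rw [hs, Finset.mul_sum, Finset.sum_eq_single_of_mem i hi, mul_smul_comm, he1 i hi]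
    intro j hj hji
    rw [mul_smul_comm, he2 i hi j hj hji.symm, smul_zero]
  have htf : ∀ j ∈ T, t * f j = j • f j := by
    intro i hi
    rw [ht, Finset.sum_mul, Finset.sum_eq_single_of_mem i hi, smul_mul_assoc, hf1 i hi]
    intro j hj hji
    rw [smul_mul_assoc, hf2 j hj i hi hji, smul_zero]
  have hz : ∀ i ∈ S, ∀ j ∈ T, i ≠ j → e i * f j = 0 := by
    intro i hi j hj hij
    have hpow : ∀ n : ℕ, e i * (((opL s - opR t) ^ n) 1) * f j = (i - j) ^ n • (e i * f j) := by
      intro n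
      induction n with
      | zero => simp
      | succ n ih =>
        rw [pow_succ']
        change e i * (s * (((opL s - opR t) ^ n) 1) - (((opL s - opR t) ^ n) 1) * t) * f j = _
        set y := ((opL s - opR t) ^ n) 1
        rw [mul_sub, sub_mul, ← mul_assoc (e i) s, hes i hi, ← mul_assoc (e i) y t,
          mul_assoc (e i * y) t, htf j hj, mul_smul_comm, smul_mul_assoc, smul_mul_assoc, ← sub_smul,
          ih, smul_smul, pow_succ']
    have h3 : QDecay fun n => ‖e i‖ * ‖((opL s - opR t) ^ n) 1‖ * ‖f j‖ := by
      intro ε hε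
      obtain ⟨K, hK, h⟩ := h2 ε hε
      refine ⟨‖e i‖ * K * ‖f j‖, by positivity, fun n => ?_⟩
      calc ‖e i‖ * ‖((opL s - opR t) ^ n) 1‖ * ‖f j‖ ≤ ‖e i‖ * (K * ε ^ n) * ‖f j‖ := by
            gcongr; exact h n
        _ = _ := by ring
    have h4 := h3.nonpos (t := ‖i - j‖) (c := ‖e i * f j‖)
      (norm_pos_iff.2 (sub_ne_zero.2 hij)) (fun n => by
        rw [← norm_pow, ← norm_smul, ← hpow n]
        exact (norm_mul_le _ _).trans (mul_le_mul_of_nonneg_right (norm_mul_le _ _) (norm_nonneg _)))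
    exact norm_le_zero_iff.1 h4
  calc s = s * ∑ j ∈ T, f j := by rw [hf3, mul_one]
    _ = ∑ i ∈ S, ∑ j ∈ T, i • (e i * f j) := by
      rw [hs, Finset.sum_mul_sum]
      simp_rw [smul_mul_assoc]
    _ = ∑ i ∈ S, ∑ j ∈ T, j • (e i * f j) := by
      refine Finset.sum_congr rfl fun i hi => Finset.sum_congr rfl fun j hj => ?_
      by_cases hij : i = j
      · rw [hij]
      · rw [hz i hi j hj hij, smul_zero, smul_zero]
    _ = (∑ i ∈ S, e i) * t := by
      rw [ht, Finset.sum_mul_sum]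
      simp_rw [mul_smul_comm]
    _ = t := by rw [he3, one_mul]
end

section
/- Let a, b, a', b' ∈ A with a commuting with a' and b commuting with b'. Then |ϱ(a',b') - ϱ(a,b)| ≤ r_σ(a - a') + r_σ(b - b'). In particular, if a_n → a and b_n → b with r_σ(a - a_n) → 0 and r_σ(b - b_n) → 0 and a_n commutes with a, b_n commutes with b, then ϱ(a,b) = lim_n ϱ(a_n, b_n). -/
def auxP {A : Type*} [NormedRing A] (a b : A) (R : ℝ) : Prop :=
  ∃ M : ℝ, 0 < M ∧ ∀ n : ℕ, ‖(fun x => a * x - x * b)^[n] 1‖ ≤ M * R ^ n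

theorem aux_add {A : Type*} [NormedRing A] (a b : A) (n : ℕ) : ∀ x y : A,
    (fun x => a * x - x * b)^[n] (x + y) =
      (fun x => a * x - x * b)^[n] x + (fun x => a * x - x * b)^[n] y := by
  induction n with
  | zero => intro x y; rfl
  | succ n ih =>
    intro x y
    simp only [Function.iterate_succ_apply]
    rw [← ih]
    congr 1
    noncomm_ring

theorem auxP_trans {A : Type*} [NormedRing A] {a b c : A} {R S : ℝ} (hR : 0 < R) (hS : 0 < S)
    (h1 : auxP a c R) (h2 : auxP c b S) : auxP a b (R + S) := by
  obtain ⟨M, hM, h1⟩ := h1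
  obtain ⟨N, hN, h2⟩ := h2
  have key : ∀ n j k : ℕ, ‖(fun x => a * x - x * b)^[n]
      ((fun x => a * x - x * c)^[j] 1 * (fun x => c * x - x * b)^[k] 1)‖
      ≤ (M * R ^ j) * (N * S ^ k) * (R + S) ^ n := by
    intro n
    induction n with
    | zero =>
      intro j k
      simp only [Function.iterate_zero, id, pow_zero, mul_one]
      exact (norm_mul_le _ _).trans (mul_le_mul (h1 j) (h2 k) (norm_nonneg _) (by positivity))
    | succ n ih =>
      intro j k
      have e : a * ((fun x => a * x - x * c)^[j] 1 * (fun x => c * x - x * b)^[k] 1)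
          - ((fun x => a * x - x * c)^[j] 1 * (fun x => c * x - x * b)^[k] 1) * b
          = (fun x => a * x - x * c)^[j+1] 1 * (fun x => c * x - x * b)^[k] 1
          + (fun x => a * x - x * c)^[j] 1 * (fun x => c * x - x * b)^[k+1] 1 := by
        simp only [Function.iterate_succ_apply']
        noncomm_ring
      rw [Function.iterate_succ_apply]
      simp only [e]
      rw [aux_add]
      calc _ ≤ _ := norm_add_le _ _
        _ ≤ _ := add_le_add (ih (j+1) k) (ih j (k+1))
        _ = _ := by ring
  refine ⟨M * N, by positivity, fun n => ?_⟩
  simpa using key n 0 0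

open Filter in
theorem auxP_of_eventually {A : Type*} [NormedRing A] {a b : A} {R : ℝ} (hR : 0 < R)
    (h : ∀ᶠ n : ℕ in atTop, ‖(fun x => a * x - x * b)^[n] 1‖ ^ ((n : ℝ)⁻¹) < R) : auxP a b R := by
  have h2 : (fun n : ℕ => (fun x => a * x - x * b)^[n] 1) =O[atTop] (fun n : ℕ => R ^ n) := by
    apply Asymptotics.IsBigO.of_bound 1
    filter_upwards [h, eventually_gt_atTop 0] with n hn h0
    rw [one_mul, Real.norm_of_nonneg (by positivity)]
    have := Real.rpow_inv_natCast_pow (norm_nonneg ((fun x => a * x - x * b)^[n] 1)) h0.ne'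
    rw [← this]
    exact pow_le_pow_left₀ (by positivity) hn.le n
  obtain ⟨C, hC, h3⟩ := Asymptotics.bound_of_isBigO_nat_atTop h2
  refine ⟨C, hC, fun n => ?_⟩
  have := h3 (x := n) (by positivity)
  rwa [Real.norm_of_nonneg (by positivity)] at this

open Filter in
theorem aux_root {A : Type*} [NormedRing A] {a b : A} {R M : ℝ} (hR : 0 < R) (hM : 0 < M)
    (h : ∀ n : ℕ, ‖(fun x => a * x - x * b)^[n] 1‖ ≤ M * R ^ n) :
    (∀ᶠ n : ℕ in atTop, ‖(fun x => a * x - x * b)^[n] 1‖ ^ ((n : ℝ)⁻¹) ≤ M ^ ((n : ℝ)⁻¹) * R)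
    ∧ Tendsto (fun n : ℕ => M ^ ((n : ℝ)⁻¹) * R) atTop (nhds R) := by
  constructor
  · filter_upwards [eventually_gt_atTop 0] with n h0
    refine (Real.rpow_le_rpow (norm_nonneg _) (h n) (by positivity)).trans ?_
    rw [Real.mul_rpow hM.le (by positivity), Real.pow_rpow_inv_natCast hR.le h0.ne']
  · have h1 : Tendsto (fun n : ℕ => M ^ ((n : ℝ)⁻¹)) atTop (nhds (M ^ (0:ℝ))) :=
      ((Real.continuous_const_rpow hM.ne').tendsto 0).comp tendsto_inv_atTop_nhds_zero_nat
    simpa using h1.mul_const R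

open Filter in
theorem auxP_le {A : Type*} [NormedRing A] {a b : A} {R : ℝ} (hR : 0 < R) (h : auxP a b R) :
    varrho a b ≤ R := by
  obtain ⟨M, hM, h⟩ := h
  obtain ⟨h1, h2⟩ := aux_root hR hM h
  rw [← h2.limsup_eq]
  refine limsup_le_limsup h1 ?_ h2.isBoundedUnder_le
  exact IsBoundedUnder.isCoboundedUnder_le ⟨0, by
    simp only [eventually_map]
    exact Eventually.of_forall fun n => by positivity⟩

theorem aux_bound {A : Type*} [NormedRing A] (a b : A) : auxP a b (‖a‖ + ‖b‖ + 1) := by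
  refine ⟨‖(1:A)‖ + 1, by positivity, fun n => ?_⟩
  induction n with
  | zero => simp
  | succ n ih =>
    rw [Function.iterate_succ_apply']
    set y := (fun x => a * x - x * b)^[n] 1
    have h1 : ‖a * y - y * b‖ ≤ ‖y‖ * (‖a‖ + ‖b‖ + 1) := by
      have := norm_sub_le (a * y) (y * b)
      have := norm_mul_le a y
      have := norm_mul_le y b
      nlinarith [norm_nonneg y]
    calc _ ≤ _ := h1
      _ ≤ _ := mul_le_mul_of_nonneg_right ih (by positivity)
      _ = _ := by ring

open Filter in
theorem auxP_of_lt {A : Type*} [NormedRing A] {a b : A} {R : ℝ} (h : varrho a b < R) :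
    0 < R ∧ auxP a b R := by
  obtain ⟨M, hM, hb⟩ := aux_bound a b
  obtain ⟨h1, h2⟩ := aux_root (by positivity) hM hb
  have hbd := h2.isBoundedUnder_le.mono_le h1
  have h3 := eventually_lt_of_limsup_lt h hbd
  have hR : 0 < R := by
    obtain ⟨n, hn⟩ := h3.exists
    exact lt_of_le_of_lt (by positivity) hn
  exact ⟨hR, auxP_of_eventually hR h3⟩

theorem aux_comm {A : Type*} [NormedRing A] {a b : A} (h : a * b = b * a) (n : ℕ) :
    (fun x => a * x - x * b)^[n] 1 = (a - b) ^ n := by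
  induction n with
  | zero => simp
  | succ n ih =>
    have hc : Commute ((a - b) ^ n) b := by
      apply Commute.pow_left
      exact Commute.sub_left h (Commute.refl b)
    rw [Function.iterate_succ_apply', ih, pow_succ', sub_mul, hc.eq]

open Filter in
theorem auxP_of_spec {A : Type*} [NormedRing A] [NormedAlgebra ℂ A] [CompleteSpace A]
    {a b : A} (h : a * b = b * a) {R : ℝ} (hR : (spectralRadius ℂ (a - b)).toReal < R) :
    0 < R ∧ auxP a b R ∧ auxP b a R := by
  have hpos : 0 < R := lt_of_le_of_lt ENNReal.toReal_nonneg hR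
  have hfin : spectralRadius ℂ (a - b) ≠ ⊤ := by
    refine ne_top_of_le_ne_top ?_ (spectrum.spectralRadius_le_pow_nnnorm_pow_one_div ℂ (a - b) 0)
    simp [← ENNReal.coe_mul]
  have ht := spectrum.pow_norm_pow_one_div_tendsto_nhds_spectralRadius (a - b)
  have h1 : spectralRadius ℂ (a - b) < ENNReal.ofReal R :=
    (ENNReal.lt_ofReal_iff_toReal_lt hfin).2 hR
  have h2 : ∀ᶠ n : ℕ in atTop, ‖(a - b) ^ n‖ ^ ((n : ℝ)⁻¹) < R := by
    filter_upwards [ht.eventually_lt_const h1] with n hn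
    rw [one_div] at hn
    exact (ENNReal.ofReal_lt_ofReal_iff hpos).1 hn
  refine ⟨hpos, auxP_of_eventually hpos ?_, auxP_of_eventually hpos ?_⟩
  · simpa only [aux_comm h] using h2
  · have e : ∀ n : ℕ, ‖(b - a) ^ n‖ = ‖(a - b) ^ n‖ := by
      intro n
      rw [← neg_sub a b, neg_pow]
      rcases neg_one_pow_eq_or A n with h | h <;> simp [h]
    simpa only [aux_comm h.symm, e] using h2

theorem aux_main {A : Type*} [NormedRing A] [NormedAlgebra ℂ A] [CompleteSpace A]
    (a b a' b' : A) (ha : a * a' = a' * a) (hb : b * b' = b' * b) :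
    |varrho a' b' - varrho a b| ≤
        (spectralRadius ℂ (a - a')).toReal + (spectralRadius ℂ (b - b')).toReal := by
  apply le_of_forall_pos_le_add
  intro ε hε
  obtain ⟨p1, q1, q1'⟩ := auxP_of_spec ha (lt_add_of_pos_right _ (by positivity : 0 < ε / 3))
  obtain ⟨p2, q2, q2'⟩ := auxP_of_spec hb (lt_add_of_pos_right _ (by positivity : 0 < ε / 3))
  obtain ⟨p3, q3⟩ := auxP_of_lt (lt_add_of_pos_right (varrho a b) (by positivity : 0 < ε / 3))
  obtain ⟨p4, q4⟩ := auxP_of_lt (lt_add_of_pos_right (varrho a' b') (by positivity : 0 < ε / 3))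
  have r1 := auxP_le (by positivity) (auxP_trans (by positivity) p2 (auxP_trans p1 p3 q1' q3) q2)
  have r2 := auxP_le (by positivity) (auxP_trans (by positivity) p2 (auxP_trans p1 p4 q1 q4) q2')
  rw [abs_le]
  constructor <;> linarith

open Filter in
theorem stmt_15 {A : Type*} [NormedRing A] [NormedAlgebra ℂ A] [CompleteSpace A] :
    (∀ a b a' b' : A, a * a' = a' * a → b * b' = b' * b →
      |varrho a' b' - varrho a b| ≤
        (spectralRadius ℂ (a - a')).toReal + (spectralRadius ℂ (b - b')).toReal) ∧
    (∀ (a b : A) (aseq bseq : ℕ → A),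
      (∀ n, a * aseq n = aseq n * a) → (∀ n, b * bseq n = bseq n * b) →
      Tendsto aseq atTop (nhds a) → Tendsto bseq atTop (nhds b) →
      Tendsto (fun n => (spectralRadius ℂ (a - aseq n)).toReal) atTop (nhds 0) →
      Tendsto (fun n => (spectralRadius ℂ (b - bseq n)).toReal) atTop (nhds 0) →
      Tendsto (fun n => varrho (aseq n) (bseq n)) atTop (nhds (varrho a b))) := by
  refine ⟨aux_main, ?_⟩
  intro a b aseq bseq ha hb _ _ h1 h2
  rw [tendsto_iff_dist_tendsto_zero]
  refine squeeze_zero (fun _ => dist_nonneg) (fun n => ?_) (by simpa using h1.add h2)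
  rw [Real.dist_eq]
  exact aux_main a b _ _ (ha n) (hb n)
end
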